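/- Under the PS&W setup, suppose g̃ : (0,∞) → [0,∞) is a measurable probability density satisfying ∫₀^∞ e^{−c²w/2} g̃(w) dw = 1/cosh(c/2) for every c ∈ ℝ. Then for any vectors ṽ₁,…,ṽₙ ∈ ℝ^p there exists a finite constant C̃ such that for every β* ∈ ℝ^p: ∫_{ℝ^p} ∫_{(0,∞)ⁿ} exp( (1/2) ∑_{i=1}^n |ṽ_iᵀβ| ) · π(β | w, y) · π(w | β*, y) dw dβ ≤ C̃. -/

import Mathlib

open Matrix MeasureTheory
open scoped ENNReal

/-- The precision matrix `UᵀΩ(w)U + B⁻¹` of the conditional Gaussian in the PS&W sampler. -/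
noncomputable def pswPrec {n p : ℕ} (U : Matrix (Fin n) (Fin p) ℝ)
    (B : Matrix (Fin p) (Fin p) ℝ) (w : Fin n → ℝ) : Matrix (Fin p) (Fin p) ℝ :=
  Uᵀ * Matrix.diagonal w * U + B⁻¹

/-- The vector `μ = Uᵀ(y − ½1ₙ) + B⁻¹b` in the PS&W setup. -/
noncomputable def pswMu {n p : ℕ} (U : Matrix (Fin n) (Fin p) ℝ)
    (B : Matrix (Fin p) (Fin p) ℝ) (b : Fin p → ℝ) (y : Fin n → ℝ) : Fin p → ℝ :=
  Uᵀ *ᵥ (fun i => y i - 1/2) + B⁻¹ *ᵥ b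

/-- The `N_p(Σ(w)μ, Σ(w))` density `π(β | w, y)` of the PS&W Gibbs sampler. -/
noncomputable def pswNormalDensity {n p : ℕ} (U : Matrix (Fin n) (Fin p) ℝ)
    (B : Matrix (Fin p) (Fin p) ℝ) (b : Fin p → ℝ) (y : Fin n → ℝ)
    (β : Fin p → ℝ) (w : Fin n → ℝ) : ℝ :=
  (2 * Real.pi) ^ (-(p : ℝ) / 2) * (pswPrec U B w).det ^ ((1 : ℝ) / 2) *
    Real.exp (-(1/2) * ((β - (pswPrec U B w)⁻¹ *ᵥ pswMu U B b y) ⬝ᵥ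
      (pswPrec U B w) *ᵥ (β - (pswPrec U B w)⁻¹ *ᵥ pswMu U B b y)))

/-- The conditional density `π(w | β, y) = ∏ᵢ cosh(uᵢᵀβ/2) exp(−(1/2)(uᵢᵀβ)² wᵢ) g̃(wᵢ)`
of the latent Polya–Gamma variables in the PS&W sampler. -/
noncomputable def pswPGDensity {n p : ℕ} (U : Matrix (Fin n) (Fin p) ℝ)
    (gt : ℝ → ℝ) (w : Fin n → ℝ) (β : Fin p → ℝ) : ℝ :=
  ∏ i, (Real.cosh ((U *ᵥ β) i / 2) * Real.exp (-(1/2) * ((U *ᵥ β) i) ^ 2 * w i) * gt (w i))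

/-- On a finite product of measures, the lower integral of a product of nonnegative integrable
functions of the individual coordinates is the product of their integrals. -/
theorem lintegral_ofReal_prod_pi {n : ℕ} {μ : Fin n → Measure ℝ} [∀ i, SigmaFinite (μ i)]
    {f : Fin n → ℝ → ℝ} (hf : ∀ i, Integrable (f i) (μ i)) (hf0 : ∀ i, 0 ≤ᵐ[μ i] f i) :
    ∫⁻ x : Fin n → ℝ, ENNReal.ofReal (∏ i, f i (x i)) ∂Measure.pi μ =
      ENNReal.ofReal (∏ i, ∫ x, f i x ∂μ i) := by
  rw [← integral_fintype_prod_eq_prod]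
  refine (ofReal_integral_eq_lintegral_ofReal (Integrable.fintype_prod hf) ?_).symm
  have h : ∀ᵐ x : Fin n → ℝ ∂Measure.pi μ, ∀ i, 0 ≤ f i (x i) :=
    ae_all_iff.2 fun i => Measure.tendsto_eval_ae_ae.eventually (hf0 i)
  filter_upwards [h] with x hx using Finset.prod_nonneg fun i _ => hx i

theorem lintegral_stdGaussian_pi (p : ℕ) :
    ∫⁻ x : Fin p → ℝ,
      ENNReal.ofReal ((2 * Real.pi) ^ (-(p : ℝ) / 2) * Real.exp (-(1/2) * (x ⬝ᵥ x))) = 1 := by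
  have h (x : Fin p → ℝ) :
      (2 * Real.pi) ^ (-(p : ℝ) / 2) * Real.exp (-(1/2) * (x ⬝ᵥ x)) =
        ∏ i, ProbabilityTheory.gaussianPDFReal 0 1 (x i) := by
    have h2 : (2 * Real.pi) ^ (-(p : ℝ) / 2) = ((√(2 * Real.pi))⁻¹) ^ p := by
      rw [Real.sqrt_eq_rpow, ← Real.rpow_neg (by positivity), ← Real.rpow_natCast,
        ← Real.rpow_mul (by positivity)]
      ring_nf
    simp only [ProbabilityTheory.gaussianPDFReal, Finset.prod_mul_distrib, ← Real.exp_sum,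
      Finset.prod_const, Finset.card_univ, Fintype.card_fin, NNReal.coe_one, mul_one, sub_zero]
    rw [h2, dotProduct, Finset.mul_sum]
    congr 3
    ext i
    ring
  simp_rw [h, volume_pi]
  rw [lintegral_ofReal_prod_pi (fun _ => ProbabilityTheory.integrable_gaussianPDFReal 0 1)
    (fun _ => Filter.Eventually.of_forall (ProbabilityTheory.gaussianPDFReal_nonneg 0 1))]
  simp [ProbabilityTheory.integral_gaussianPDFReal_eq_one]

open scoped MatrixOrder ComplexOrder in
theorem Matrix.PosDef.exists_eq_transpose_mul_self {p : ℕ} {P : Matrix (Fin p) (Fin p) ℝ}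
    (hP : P.PosDef) : ∃ S : Matrix (Fin p) (Fin p) ℝ, P = Sᵀ * S := by
  obtain ⟨S, hS⟩ := CStarAlgebra.nonneg_iff_eq_star_mul_self.1 hP.posSemidef.nonneg
  exact ⟨S, by simpa [star_eq_conjTranspose] using hS⟩

/-- The `N_p(a, P⁻¹)` density integrates to one. -/
theorem lintegral_multivariateGaussian {p : ℕ} {P : Matrix (Fin p) (Fin p) ℝ} (hP : P.PosDef)
    (a : Fin p → ℝ) :
    ∫⁻ x : Fin p → ℝ, ENNReal.ofReal ((2 * Real.pi) ^ (-(p : ℝ) / 2) * P.det ^ ((1 : ℝ) / 2) *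
      Real.exp (-(1/2) * ((x - a) ⬝ᵥ P *ᵥ (x - a)))) = 1 := by
  obtain ⟨S, rfl⟩ := hP.exists_eq_transpose_mul_self
  have hdet : (Sᵀ * S).det ^ ((1 : ℝ) / 2) = |S.det| := by
    rw [det_mul, det_transpose, ← Real.sqrt_eq_rpow, Real.sqrt_mul_self_eq_abs]
  have hS : S.det ≠ 0 := fun h => hP.det_pos.ne' (by simp [h])
  rw [lintegral_sub_right_eq_self (fun x : Fin p → ℝ => ENNReal.ofReal
    ((2 * Real.pi) ^ (-(p : ℝ) / 2) * (Sᵀ * S).det ^ ((1 : ℝ) / 2) *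
      Real.exp (-(1/2) * (x ⬝ᵥ (Sᵀ * S) *ᵥ x)))) a]
  let f : (Fin p → ℝ) → ℝ≥0∞ := fun x =>
    ENNReal.ofReal ((2 * Real.pi) ^ (-(p : ℝ) / 2) * Real.exp (-(1/2) * (x ⬝ᵥ x)))
  have hf : Measurable f := by
    refine ENNReal.measurable_ofReal.comp (Continuous.measurable ?_)
    fun_prop
  have hcov : ∫⁻ x, f (S *ᵥ x) = ENNReal.ofReal |S.det|⁻¹ := by
    have h := lintegral_map (μ := volume) hf
      (Matrix.toLin' S).continuous_of_finiteDimensional.measurable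
    rw [Real.map_matrix_volume_pi_eq_smul_volume_pi hS, lintegral_smul_measure,
      lintegral_stdGaussian_pi] at h
    simpa [abs_inv] using h.symm
  have hpt (x : Fin p → ℝ) : ENNReal.ofReal
      ((2 * Real.pi) ^ (-(p : ℝ) / 2) * (Sᵀ * S).det ^ ((1 : ℝ) / 2) *
        Real.exp (-(1/2) * (x ⬝ᵥ (Sᵀ * S) *ᵥ x))) = ENNReal.ofReal |S.det| * f (S *ᵥ x) := by
    rw [hdet, ← ENNReal.ofReal_mul (abs_nonneg _), ← mulVec_mulVec, dotProduct_transpose_mulVec]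
    ring_nf
  simp_rw [hpt]
  rw [lintegral_const_mul' _ _ ENNReal.ofReal_ne_top, hcov, ← ENNReal.ofReal_mul (abs_nonneg _),
    mul_inv_cancel₀ (abs_ne_zero.2 hS), ENNReal.ofReal_one]

theorem Matrix.IsSymm.dotProduct_mulVec_comm {p : ℕ} {A : Matrix (Fin p) (Fin p) ℝ}
    (hA : A.IsSymm) (x z : Fin p → ℝ) : x ⬝ᵥ A *ᵥ z = z ⬝ᵥ A *ᵥ x := by
  conv_lhs => rw [← hA.eq]
  exact dotProduct_transpose_mulVec A x z

theorem Matrix.PosDef.isSymm {p : ℕ} {A : Matrix (Fin p) (Fin p) ℝ} (hA : A.PosDef) :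
    A.IsSymm := by
  simpa [IsHermitian, IsSymm] using hA.isHermitian

theorem Matrix.PosDef.mulVec_inv_mulVec {p : ℕ} {A : Matrix (Fin p) (Fin p) ℝ} (hA : A.PosDef)
    (x : Fin p → ℝ) : A *ᵥ (A⁻¹ *ᵥ x) = x := by
  rw [mulVec_mulVec, mul_nonsing_inv _ hA.det_pos.ne'.isUnit, one_mulVec]

/-- Completing the square in an exponentially tilted Gaussian density. -/
theorem Matrix.PosDef.complete_square {p : ℕ} {P : Matrix (Fin p) (Fin p) ℝ} (hP : P.PosDef)
    (t m x : Fin p → ℝ) :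
    t ⬝ᵥ x + -(1/2) * ((x - P⁻¹ *ᵥ m) ⬝ᵥ P *ᵥ (x - P⁻¹ *ᵥ m)) =
      (1/2) * ((t + m) ⬝ᵥ P⁻¹ *ᵥ (t + m)) - (1/2) * (m ⬝ᵥ P⁻¹ *ᵥ m) +
        -(1/2) * ((x - P⁻¹ *ᵥ (t + m)) ⬝ᵥ P *ᵥ (x - P⁻¹ *ᵥ (t + m))) := by
  have h (s : Fin p → ℝ) : (x - P⁻¹ *ᵥ s) ⬝ᵥ P *ᵥ (x - P⁻¹ *ᵥ s) =
      x ⬝ᵥ P *ᵥ x - 2 * (s ⬝ᵥ x) + s ⬝ᵥ P⁻¹ *ᵥ s := by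
    have h1 := hP.isSymm.dotProduct_mulVec_comm (P⁻¹ *ᵥ s) x
    rw [mulVec_sub, sub_dotProduct, dotProduct_sub, dotProduct_sub, h1, hP.mulVec_inv_mulVec,
      dotProduct_comm x s, dotProduct_comm (P⁻¹ *ᵥ s) s]
    ring
  rw [h m, h (t + m), add_dotProduct t m x]
  ring

/-- If `B⁻¹ ≤ P` in the Loewner order then `P⁻¹ ≤ B`. -/
theorem Matrix.PosDef.dotProduct_inv_mulVec_le {p : ℕ} {P B : Matrix (Fin p) (Fin p) ℝ}
    (hP : P.PosDef) (hB : B.PosDef) (hPB : ∀ x, x ⬝ᵥ B⁻¹ *ᵥ x ≤ x ⬝ᵥ P *ᵥ x)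
    (s : Fin p → ℝ) : s ⬝ᵥ P⁻¹ *ᵥ s ≤ s ⬝ᵥ B *ᵥ s := by
  set x := P⁻¹ *ᵥ s with hx
  have h1 := hPB x
  have h2 : 0 ≤ (x - B *ᵥ s) ⬝ᵥ B⁻¹ *ᵥ (x - B *ᵥ s) := by
    simpa using hB.inv.posSemidef.dotProduct_mulVec_nonneg (x - B *ᵥ s)
  have h3 : B⁻¹ *ᵥ (B *ᵥ s) = s := by
    rw [mulVec_mulVec, nonsing_inv_mul _ hB.det_pos.ne'.isUnit, one_mulVec]
  rw [mulVec_sub, h3, sub_dotProduct, dotProduct_sub, dotProduct_sub,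
    hB.inv.isSymm.dotProduct_mulVec_comm (B *ᵥ s) x, h3, dotProduct_comm (B *ᵥ s) s] at h2
  rw [hx, hP.mulVec_inv_mulVec, ← hx] at h1
  rw [dotProduct_comm s x]
  linarith

section PSW

variable {n p : ℕ} (U : Matrix (Fin n) (Fin p) ℝ) {B : Matrix (Fin p) (Fin p) ℝ}

theorem pswPrec_posDef (hB : B.PosDef) {w : Fin n → ℝ} (hw : ∀ i, 0 ≤ w i) :
    (pswPrec U B w).PosDef := by
  have h := (posSemidef_diagonal_iff.2 hw).conjTranspose_mul_mul_same U
  rw [conjTranspose_eq_transpose_of_trivial] at h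
  exact PosDef.posSemidef_add h hB.inv

theorem le_dotProduct_pswPrec_mulVec {w : Fin n → ℝ} (hw : ∀ i, 0 ≤ w i)
    (x : Fin p → ℝ) : x ⬝ᵥ B⁻¹ *ᵥ x ≤ x ⬝ᵥ pswPrec U B w *ᵥ x := by
  have h := ((posSemidef_diagonal_iff.2 hw).conjTranspose_mul_mul_same U).dotProduct_mulVec_nonneg x
  rw [conjTranspose_eq_transpose_of_trivial, star_trivial] at h
  rw [pswPrec, add_mulVec, dotProduct_add]
  linarith

/-- The moment generating function of `π(· | w, y)` is bounded uniformly in `w`. -/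
theorem lintegral_exp_mul_pswNormalDensity_le (hB : B.PosDef) (b : Fin p → ℝ) (y : Fin n → ℝ)
    {w : Fin n → ℝ} (hw : ∀ i, 0 ≤ w i) (t : Fin p → ℝ) :
    ∫⁻ β : Fin p → ℝ, ENNReal.ofReal (Real.exp (t ⬝ᵥ β) * pswNormalDensity U B b y β w) ≤
      ENNReal.ofReal
        (Real.exp ((1/2) * ((t + pswMu U B b y) ⬝ᵥ B *ᵥ (t + pswMu U B b y)))) := by
  have hP := pswPrec_posDef U hB hw
  set P := pswPrec U B w with hPdef
  set m := pswMu U B b y with hm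
  set c := Real.exp ((1/2) * ((t + m) ⬝ᵥ P⁻¹ *ᵥ (t + m)) - (1/2) * (m ⬝ᵥ P⁻¹ *ᵥ m))
  have hpt (β : Fin p → ℝ) : ENNReal.ofReal (Real.exp (t ⬝ᵥ β) * pswNormalDensity U B b y β w) =
      ENNReal.ofReal c * ENNReal.ofReal ((2 * Real.pi) ^ (-(p : ℝ) / 2) * P.det ^ ((1 : ℝ) / 2) *
        Real.exp (-(1/2) * ((β - P⁻¹ *ᵥ (t + m)) ⬝ᵥ P *ᵥ (β - P⁻¹ *ᵥ (t + m))))) := by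
    rw [← ENNReal.ofReal_mul (Real.exp_nonneg _), pswNormalDensity, ← hPdef, ← hm,
      mul_left_comm, ← Real.exp_add, hP.complete_square, Real.exp_add]
    ring_nf
  simp_rw [hpt]
  rw [lintegral_const_mul' _ _ ENNReal.ofReal_ne_top, lintegral_multivariateGaussian hP, mul_one]
  refine ENNReal.ofReal_le_ofReal (Real.exp_le_exp.2 ?_)
  have h1 := hP.dotProduct_inv_mulVec_le hB (le_dotProduct_pswPrec_mulVec U hw) (t + m)
  have h2 : 0 ≤ m ⬝ᵥ P⁻¹ *ᵥ m := by
    simpa using hP.inv.posSemidef.dotProduct_mulVec_nonneg m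
  linarith

theorem pswNormalDensity_nonneg (hB : B.PosDef) (b : Fin p → ℝ) (y : Fin n → ℝ)
    (β : Fin p → ℝ) {w : Fin n → ℝ} (hw : ∀ i, 0 ≤ w i) : 0 ≤ pswNormalDensity U B b y β w := by
  have := (pswPrec_posDef U hB hw).det_pos
  unfold pswNormalDensity
  positivity

theorem continuous_pswPrec : Continuous (pswPrec U B) := by
  unfold pswPrec
  fun_prop

theorem measurable_pswNormalDensity (b : Fin p → ℝ) (y : Fin n → ℝ) :
    Measurable fun z : (Fin p → ℝ) × (Fin n → ℝ) => pswNormalDensity U B b y z.1 z.2 := by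
  have hP := continuous_pswPrec U (B := B)
  have hdet : Measurable fun w => (pswPrec U B w).det := hP.matrix_det.measurable
  have hmean : Measurable fun w => (pswPrec U B w)⁻¹ *ᵥ pswMu U B b y := by
    simp_rw [inv_def, smul_mulVec, Ring.inverse_eq_inv']
    exact hdet.inv.smul (hP.matrix_adjugate.matrix_mulVec continuous_const).measurable
  have hquad : Measurable fun z : (Fin p → ℝ) × (Fin n → ℝ) => z.1 ⬝ᵥ pswPrec U B z.2 *ᵥ z.1 :=
    (continuous_fst.dotProduct
      ((hP.comp continuous_snd).matrix_mulVec continuous_fst)).measurable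
  have hcomp := hquad.comp
    ((measurable_fst.sub (hmean.comp measurable_snd)).prodMk
      (measurable_snd : Measurable (Prod.snd : (Fin p → ℝ) × (Fin n → ℝ) → _)))
  unfold pswNormalDensity
  exact (((hdet.comp measurable_snd).pow_const _).const_mul _).mul
    (Real.measurable_exp.comp (hcomp.const_mul _))

theorem measurable_pswPGDensity {gt : ℝ → ℝ} (hgt : Measurable gt) (β : Fin p → ℝ) :
    Measurable fun w => pswPGDensity U gt w β := by
  unfold pswPGDensity
  fun_prop

/-- `π(· | β, y)` is a probability density on `(0,∞)ⁿ`. -/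
theorem lintegral_pswPGDensity {gt : ℝ → ℝ} (hgt_nonneg : ∀ w, 0 < w → 0 ≤ gt w)
    (hgt_laplace : ∀ c : ℝ,
      ∫ w in Set.Ioi (0 : ℝ), Real.exp (-(c ^ 2) * w / 2) * gt w = 1 / Real.cosh (c / 2))
    (β : Fin p → ℝ) :
    ∫⁻ w : Fin n → ℝ, ENNReal.ofReal (pswPGDensity U gt w β)
      ∂(Measure.pi fun _ : Fin n => volume.restrict (Set.Ioi (0 : ℝ))) = 1 := by
  have hfun (c : ℝ) : (fun w => Real.cosh (c / 2) * Real.exp (-(1/2) * c ^ 2 * w) * gt w) =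
      fun w => Real.cosh (c / 2) * (Real.exp (-(c ^ 2) * w / 2) * gt w) := by
    ext w
    rw [mul_assoc]
    ring_nf
  have hint (c : ℝ) : IntegrableOn (fun w => Real.exp (-(c ^ 2) * w / 2) * gt w) (Set.Ioi 0) := by
    refine Integrable.of_integral_ne_zero ?_
    rw [hgt_laplace]
    exact (one_div_pos.2 (Real.cosh_pos _)).ne'
  unfold pswPGDensity
  rw [lintegral_ofReal_prod_pi
    (f := fun i w => Real.cosh ((U *ᵥ β) i / 2) * Real.exp (-(1/2) * ((U *ᵥ β) i) ^ 2 * w) * gt w)]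
  · simp_rw [hfun, integral_const_mul, hgt_laplace, mul_one_div_cancel (Real.cosh_pos _).ne']
    simp
  · intro i
    simp_rw [hfun]
    exact (hint _).const_mul _
  · intro i
    filter_upwards [ae_restrict_mem measurableSet_Ioi] with w hw
    have := hgt_nonneg w hw
    have := Real.cosh_pos ((U *ᵥ β) i / 2)
    simp only [Pi.zero_apply]
    positivity

end PSW

/-- Up to a finite sum over sign patterns, an exponential of absolute values of linear forms is
an exponential of a linear form. -/
theorem exp_half_sum_abs_le {n p : ℕ} (v : Fin n → Fin p → ℝ) (β : Fin p → ℝ) :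
    Real.exp ((1/2) * ∑ i, |v i ⬝ᵥ β|) ≤
      ∑ σ : Fin n → SignType, Real.exp (((1/2 : ℝ) • ∑ i, (σ i : ℝ) • v i) ⬝ᵥ β) := by
  refine le_of_eq_of_le ?_ (Finset.single_le_sum (fun _ _ => Real.exp_nonneg _)
    (Finset.mem_univ fun i => SignType.sign (v i ⬝ᵥ β)))
  simp [sum_dotProduct, smul_dotProduct, sign_mul_self]

/-- If `f` is bounded by a finite sum of exponentials of linear forms, its expectation under
`π(· | w, y)` is bounded uniformly in `w`. -/
theorem lintegral_mul_pswNormalDensity_le {ι : Type*} [Fintype ι] {n p : ℕ}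
    (U : Matrix (Fin n) (Fin p) ℝ) {B : Matrix (Fin p) (Fin p) ℝ} (hB : B.PosDef)
    (b : Fin p → ℝ) (y : Fin n → ℝ) {f : (Fin p → ℝ) → ℝ} {t : ι → Fin p → ℝ}
    (hf : ∀ β, f β ≤ ∑ k, Real.exp (t k ⬝ᵥ β)) {w : Fin n → ℝ} (hw : ∀ i, 0 ≤ w i) :
    ∫⁻ β : Fin p → ℝ, ENNReal.ofReal (f β * pswNormalDensity U B b y β w) ≤
      ENNReal.ofReal
        (∑ k, Real.exp ((1/2) * ((t k + pswMu U B b y) ⬝ᵥ B *ᵥ (t k + pswMu U B b y)))) := by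
  have hN0 (β) := pswNormalDensity_nonneg U hB b y β hw
  have hNw : Measurable fun β => pswNormalDensity U B b y β w :=
    Measurable.of_uncurry_right (f := pswNormalDensity U B b y) (measurable_pswNormalDensity U b y)
  calc
    _ ≤ ∫⁻ β, ∑ k, ENNReal.ofReal (Real.exp (t k ⬝ᵥ β) * pswNormalDensity U B b y β w) := by
      refine lintegral_mono fun β => ?_
      rw [← ENNReal.ofReal_sum_of_nonneg
        fun k _ => mul_nonneg (Real.exp_nonneg _) (hN0 β), ← Finset.sum_mul]
      exact ENNReal.ofReal_le_ofReal (mul_le_mul_of_nonneg_right (hf β) (hN0 β))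
    _ = ∑ k, ∫⁻ β, ENNReal.ofReal (Real.exp (t k ⬝ᵥ β) * pswNormalDensity U B b y β w) := by
      refine lintegral_finsetSum _ fun k _ => ENNReal.measurable_ofReal.comp
        (Measurable.mul (Continuous.measurable ?_) hNw)
      fun_prop
    _ ≤ _ := by
      rw [ENNReal.ofReal_sum_of_nonneg fun k _ => Real.exp_nonneg _]
      exact Finset.sum_le_sum fun k _ =>
        lintegral_exp_mul_pswNormalDensity_le U hB b y hw (t k)

/-- Bound (39) in the proof of Theorem 5: the expectation of
`exp((1/2) ∑ᵢ |ṽᵢᵀβ|)` under one step of the PS&W Markov transition density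
`k(β*, β) = ∫ π(β | w, y) π(w | β*, y) dw` is bounded uniformly in the starting point `β*`. -/
theorem stmt_13 {n p : ℕ} (hn : 0 < n) (hp : 0 < p)
    (U : Matrix (Fin n) (Fin p) ℝ) (B : Matrix (Fin p) (Fin p) ℝ) (hB : B.PosDef)
    (b : Fin p → ℝ) (y : Fin n → ℝ) (hy : ∀ i, y i = 0 ∨ y i = 1)
    (gt : ℝ → ℝ) (hgt_meas : Measurable gt) (hgt_nonneg : ∀ w, 0 < w → 0 ≤ gt w)
    (hgt_laplace : ∀ c : ℝ,
      ∫ w in Set.Ioi (0 : ℝ), Real.exp (-(c ^ 2) * w / 2) * gt w = 1 / Real.cosh (c / 2))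
    (v : Fin n → Fin p → ℝ) :
    ∃ Ct : ℝ, ∀ βs : Fin p → ℝ,
      ∫⁻ β : Fin p → ℝ,
        (∫⁻ w : Fin n → ℝ, ENNReal.ofReal
            (Real.exp ((1/2) * ∑ i, |v i ⬝ᵥ β|) *
              pswNormalDensity U B b y β w * pswPGDensity U gt w βs)
          ∂(Measure.pi fun _ : Fin n => volume.restrict (Set.Ioi (0 : ℝ)))) ∂volume
        ≤ ENNReal.ofReal Ct := by
  obtain ⟨K, hK⟩ : ∃ K : ℝ, ∀ w : Fin n → ℝ, (∀ i, 0 ≤ w i) →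
      ∫⁻ β : Fin p → ℝ, ENNReal.ofReal
        (Real.exp ((1/2) * ∑ i, |v i ⬝ᵥ β|) * pswNormalDensity U B b y β w) ≤
          ENNReal.ofReal K :=
    ⟨_, fun _ hw => lintegral_mul_pswNormalDensity_le U hB b y (exp_half_sum_abs_le v) hw⟩
  refine ⟨K, fun βs => ?_⟩
  have hpos : ∀ᵐ w : Fin n → ℝ ∂(Measure.pi fun _ : Fin n => volume.restrict (Set.Ioi (0 : ℝ))),
      ∀ i, 0 < w i :=
    ae_all_iff.2 fun i => Measure.tendsto_eval_ae_ae.eventually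
      (ae_restrict_mem measurableSet_Ioi)
  rw [lintegral_lintegral_swap]
  · calc
      _ ≤ ∫⁻ w, ENNReal.ofReal K * ENNReal.ofReal (pswPGDensity U gt w βs)
            ∂(Measure.pi fun _ : Fin n => volume.restrict (Set.Ioi (0 : ℝ))) := by
        refine lintegral_mono_ae ?_
        filter_upwards [hpos] with w hw
        have hw0 : ∀ i, 0 ≤ w i := fun i => (hw i).le
        rw [lintegral_congr fun β => ENNReal.ofReal_mul (mul_nonneg
            (Real.exp_nonneg ((1/2) * ∑ i, |v i ⬝ᵥ β|)) (pswNormalDensity_nonneg U hB b y β hw0)),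
          lintegral_mul_const' _ _ ENNReal.ofReal_ne_top]
        exact mul_le_mul_left (hK w hw0) _
      _ = _ := by
        rw [lintegral_const_mul' _ _ ENNReal.ofReal_ne_top,
          lintegral_pswPGDensity U hgt_nonneg hgt_laplace, mul_one]
  · have hE : Continuous fun β : Fin p → ℝ => Real.exp ((1/2) * ∑ i, |v i ⬝ᵥ β|) := by fun_prop
    exact (ENNReal.measurable_ofReal.comp
      (((hE.measurable.comp measurable_fst).mul (measurable_pswNormalDensity U b y)).mul
        ((measurable_pswPGDensity U hgt_meas βs).comp measurable_snd))).aemeasurable
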